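/- arXiv:2403.19701 — 3 statements merged into one kernel-verified Lean document; each statement's English description precedes it below -/
import Mathlib

section
/- For every integer n ≥ 1, 2 · ∑_{j=0}^{n} F(j) · P(n-j) = P(n+2) + P(n-1) − F(n+2). -/
/-- Fibonacci `m`-step numbers: `fibm m 0 = 0`, `fibm m 1 = 1`, and for `n ≥ 2`,
`fibm m n = ∑_{j=1}^{m} fibm m (n - j)`, negative indices counting as `0`
(equivalently via truncated subtraction, since `fibm m 0 = 0`). -/
def fibm (m : ℕ) : ℕ → ℤ
  | 0 => 0
  | 1 => 1
  | n + 2 => ∑ j ∈ Finset.range m, fibm m (n + 1 - j)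
decreasing_by exact Nat.lt_succ_of_le (Nat.sub_le _ _)

theorem fibm_add_two (m n : ℕ) :
    fibm m (n + 2) = ∑ j ∈ Finset.range m, fibm m (n + 1 - j) := by
  rw [fibm]

theorem fibm_zero (m : ℕ) : fibm m 0 = 0 := by rw [fibm]

theorem fibm_one (m : ℕ) : fibm m 1 = 1 := by rw [fibm]

theorem fibm_two_add_two (n : ℕ) : fibm 2 (n + 2) = fibm 2 (n + 1) + fibm 2 n := by
  simp [fibm_add_two, Finset.sum_range_succ]

theorem fibm_five_add_five (n : ℕ) :
    fibm 5 (n + 5) =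
      fibm 5 (n + 4) + fibm 5 (n + 3) + fibm 5 (n + 2) + fibm 5 (n + 1) + fibm 5 n := by
  rw [fibm_add_two 5 (n + 3)]
  simp [Finset.sum_range_succ]

/-- Convolving with the Fibonacci numbers gives an inhomogeneous Fibonacci recurrence. -/
theorem sum_fibm_two_mul_add_two (f : ℕ → ℤ) (n : ℕ) :
    ∑ j ∈ Finset.range (n + 3), fibm 2 j * f (n + 2 - j) =
      ∑ j ∈ Finset.range (n + 2), fibm 2 j * f (n + 1 - j) +
        ∑ j ∈ Finset.range (n + 1), fibm 2 j * f (n - j) + f (n + 1) := by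
  rw [Finset.sum_range_succ', Finset.sum_range_succ', Finset.sum_range_succ' _ (n + 1)]
  simp [fibm_two_add_two, fibm_zero, fibm_one, add_mul, Finset.sum_add_distrib]

theorem stmt_7 (n : ℕ) (hn : 1 ≤ n) :
    2 * ∑ j ∈ Finset.range (n + 1), fibm 2 j * fibm 5 (n - j) =
      fibm 5 (n + 2) + fibm 5 (n - 1) - fibm 2 (n + 2) := by
  obtain ⟨k, rfl⟩ := Nat.exists_eq_add_of_le' hn
  clear hn
  induction k using Nat.twoStepInduction with
  | zero => simp [Finset.sum_range_succ, fibm_add_two, fibm_zero, fibm_one]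
  | one => simp [Finset.sum_range_succ, fibm_add_two, fibm_zero, fibm_one]
  | more k ih₀ ih₁ =>
    have hS := sum_fibm_two_mul_add_two (fibm 5) (k + 1)
    have hP := fibm_five_add_five k
    have hF := fibm_two_add_two (k + 3)
    simp only [Nat.add_assoc, Nat.reduceAdd, Nat.add_sub_cancel,
      Nat.add_succ_sub_one] at *
    linarith
end

section
/- Let m ≥ 3 be an integer. For all integers n ≥ 2, ∑_{j=0}^{n} F^{(m)}(j) · F^{(m-2)}(n-j) = J(n-1) + ∑_{j=0}^{n-2} J(j) · (F^{(m-2)}(n-j) − F^{(m)}(n-2-j)). -/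
/-- Jacobsthal numbers: `jac 0 = 0`, `jac 1 = 1`, `jac (n+2) = jac (n+1) + 2 * jac n`. -/
def jac : ℕ → ℤ
  | 0 => 0
  | 1 => 1
  | n + 2 => jac (n + 1) + 2 * jac n

open PowerSeries in
/-- The generating function of `fibm k` is `X / (1 - X - ⋯ - X ^ k)`. -/
theorem mk_fibm_mul (k : ℕ) :
    (mk (fibm k) : ℤ⟦X⟧) * (1 - ∑ i ∈ Finset.range k, X ^ (i + 1)) = X := by
  ext n
  rw [mul_sub, mul_one, map_sub, Finset.mul_sum, map_sum, coeff_mk, coeff_X]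
  simp only [coeff_mul_X_pow', coeff_mk]
  match n with
  | 0 => simp [fibm]
  | 1 =>
    rw [Finset.sum_eq_zero]
    · simp [fibm]
    · intro i _
      split_ifs with h
      · obtain rfl : i = 0 := by omega
        simp [fibm]
      · rfl
  | n + 2 =>
    rw [fibm, if_neg (by omega), sub_eq_zero]
    refine Finset.sum_congr rfl fun i _ => ?_
    split_ifs with h
    · congr 1
      omega
    · rw [show n + 1 - i = 0 by omega, fibm]

open PowerSeries in
/-- The generating function of the Jacobsthal numbers is `X / (1 - X - 2 * X ^ 2)`. -/
theorem mk_jac_mul : (mk jac : ℤ⟦X⟧) * (1 - X ^ 1 - 2 * X ^ 2) = X := by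
  ext n
  rw [show (mk jac : ℤ⟦X⟧) * (1 - X ^ 1 - 2 * X ^ 2) =
    mk jac - mk jac * X ^ 1 - (mk jac * X ^ 2 + mk jac * X ^ 2) by ring]
  simp only [map_sub, map_add, coeff_mul_X_pow', coeff_mk, coeff_X]
  match n with
  | 0 => simp [jac]
  | 1 => simp [jac]
  | n + 2 =>
    simp [jac]
    ring

open PowerSeries in
theorem mk_fibm_mul_mk_fibm_add_two (k : ℕ) :
    (mk (fibm (k + 2)) : ℤ⟦X⟧) * mk (fibm k) =
      mk jac * mk (fibm k) - mk jac * mk (fibm (k + 2)) * X ^ 2 := by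
  have hA := mk_fibm_mul (k + 2)
  have hB := mk_fibm_mul k
  have hJ := mk_jac_mul
  have hP : ∑ i ∈ Finset.range (k + 2), (X : ℤ⟦X⟧) ^ (i + 1) =
      X + X ^ 2 + X ^ 2 * ∑ i ∈ Finset.range k, X ^ (i + 1) := by
    rw [Finset.sum_range_succ', Finset.sum_range_succ', Finset.mul_sum]
    simp only [← pow_add]
    rw [Finset.sum_congr rfl fun i _ => by rw [show i + 1 + 1 + 1 = 2 + (i + 1) by ring]]
    ring
  rw [hP] at hA
  apply mul_left_cancel₀ (X_ne_zero (R := ℤ))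
  linear_combination (mk jac * mk (fibm k)) * hA - (mk (fibm (k + 2)) * mk (fibm k)) * hJ -
    (X ^ 2 * mk jac * mk (fibm (k + 2))) * hB


theorem stmt_14 (m : ℕ) (hm : 3 ≤ m) (n : ℕ) (hn : 2 ≤ n) :
    ∑ j ∈ Finset.range (n + 1), fibm m j * fibm (m - 2) (n - j) =
      jac (n - 1) +
        ∑ j ∈ Finset.range (n - 1), jac j * (fibm (m - 2) (n - j) - fibm m (n - 2 - j)) := by
  obtain ⟨k, rfl⟩ : ∃ k, m = k + 2 := ⟨m - 2, by omega⟩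
  obtain ⟨n, rfl⟩ : ∃ l, n = l + 2 := ⟨n - 2, by omega⟩
  have h := congrArg (PowerSeries.coeff (n + 2)) (mk_fibm_mul_mk_fibm_add_two k)
  rw [map_sub, PowerSeries.coeff_mul_X_pow] at h
  simp only [PowerSeries.coeff_mul, PowerSeries.coeff_mk,
    Finset.Nat.sum_antidiagonal_eq_sum_range_succ_mk] at h
  simp only [Nat.add_sub_cancel, show n + 2 - 1 = n + 1 from rfl, mul_sub,
    Finset.sum_sub_distrib]
  rw [h, Finset.sum_range_succ _ (n + 2), Finset.sum_range_succ _ (n + 1), Nat.sub_self,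
    show n + 2 - (n + 1) = 1 by omega, fibm, fibm]
  ring
end

section
/- Let m ≥ 1 be an integer. For all integers n ≥ 2m+2, the sum over all quadruples (k₁, k₂, k₃, k₄) of nonnegative integers with k₁ + k₂ + k₃ + k₄ = n − 2m − 2 of F^{(m)}(k₁) · F^{(m+1)}(k₂) · F^{(m+2)}(k₃) · F^{(m+3)}(k₄) equals ∑_{j=0}^{n} (F^{(m+3)}(j) − F^{(m+2)}(j)) · (F^{(m+1)}(n-j) − F^{(m)}(n-j)). -/
open PowerSeries in
/-- The generating function `F = ∑ fibm m n Xⁿ` satisfies `F = X + (X + ⋯ + X ^ m) F`. -/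
theorem mk_fibm_eq (m : ℕ) :
    mk (fibm m) = X + (∑ j ∈ Finset.range m, X ^ (j + 1)) * mk (fibm m) := by
  ext n
  rw [Finset.sum_mul, map_add, map_sum]
  simp only [coeff_X_pow_mul', coeff_mk, coeff_X]
  match n with
  | 0 => simp [fibm]
  | 1 =>
    have h : ∀ j ∈ Finset.range m, (if j + 1 ≤ 1 then fibm m (1 - (j + 1)) else 0) = 0 := by
      intro j _
      split_ifs <;> simp [fibm]
    rw [Finset.sum_eq_zero h]
    simp [fibm]
  | n + 2 =>
    rw [fibm, if_neg (by omega), zero_add]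
    refine Finset.sum_congr rfl fun j _ => ?_
    split_ifs with h
    · congr 1
      omega
    · rw [show n + 1 - j = 0 by omega, fibm]

open PowerSeries in
/-- Consecutive generating functions `F`, `F'` of the `fibm` sequences satisfy
`F' - F = X ^ m F F'`. -/
theorem mk_fibm_succ_sub (m : ℕ) :
    mk (fibm (m + 1)) - mk (fibm m) = X ^ m * mk (fibm m) * mk (fibm (m + 1)) := by
  have h₀ := mk_fibm_eq m
  have h₁ := mk_fibm_eq (m + 1)
  rw [Finset.sum_range_succ] at h₁
  apply mul_left_cancel₀ (X_ne_zero (R := ℤ))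
  linear_combination mk (fibm m) * h₁ - mk (fibm (m + 1)) * h₀

open PowerSeries in
/-- Coefficients of a product of `k` power series as a sum over `antidiagonalTuple`. -/
theorem coeff_prod_fin {R : Type*} [CommSemiring R] {k : ℕ} (f : Fin k → R⟦X⟧) (n : ℕ) :
    coeff n (∏ i, f i) =
      ∑ x ∈ Finset.Nat.antidiagonalTuple k n, ∏ i, coeff (x i) (f i) := by
  rw [coeff_prod]
  refine Finset.sum_nbij' (fun x => ⇑x) (fun x => Finsupp.equivFunOnFinite.symm x) ?_ ?_ ?_ ?_ ?_
  all_goals simp [Finset.Nat.mem_antidiagonalTuple]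

theorem stmt_19 (m : ℕ) (hm : 1 ≤ m) (n : ℕ) (hn : 2 * m + 2 ≤ n) :
    ∑ k ∈ Finset.Nat.antidiagonalTuple 4 (n - (2 * m + 2)),
        fibm m (k 0) * fibm (m + 1) (k 1) * fibm (m + 2) (k 2) * fibm (m + 3) (k 3) =
      ∑ j ∈ Finset.range (n + 1),
        (fibm (m + 3) j - fibm (m + 2) j) * (fibm (m + 1) (n - j) - fibm m (n - j)) := by
  open PowerSeries in
  have key : (mk (fibm (m + 3)) - mk (fibm (m + 2))) * (mk (fibm (m + 1)) - mk (fibm m)) =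
      X ^ (2 * m + 2) * ∏ i : Fin 4, mk (fibm (m + i)) := by
    rw [mk_fibm_succ_sub (m + 2), mk_fibm_succ_sub m]
    simp only [Fin.prod_univ_four, Fin.val_zero, Fin.val_one, Fin.val_two,
      show ((3 : Fin 4) : ℕ) = 3 from rfl, add_zero]
    ring
  have h := congrArg (coeff n) key
  rw [coeff_X_pow_mul', if_pos hn, coeff_prod_fin, coeff_mul,
    Finset.Nat.sum_antidiagonal_eq_sum_range_succ_mk] at h
  simpa [Fin.prod_univ_four] using h.symm
end
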